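/- arXiv:1410.2113 — 2 statements merged into one kernel-verified Lean document; each statement's English description precedes it below -/
import Mathlib

section
/- Let $d \ge 1$ and let $\alpha > d/2$ be a non-integer real number, with $a_0 = 1$, $a_k = \alpha(\alpha-1)\cdots(\alpha-k+1)/k!$ for $k \ge 1$, and $K_J = \lfloor\alpha\rfloor + 2J + 1$. Then $\lim_{J \to \infty} \int_{\{\xi \in \mathbb{R}^d : |\xi| \ge 1\}} \left( \sum_{k=0}^{K_J} a_k\, |\xi|^{2k} \right)^{-1} d\xi = 0$. -/
open Filter MeasureTheory

/-- Generalized binomial coefficients: `a α 0 = 1`,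
`a α k = α (α-1) ⋯ (α-k+1) / k!` for `k ≥ 1`. -/
noncomputable def a (α : ℝ) (k : ℕ) : ℝ :=
  (∏ i ∈ Finset.range k, (α - i)) / (Nat.factorial k : ℝ)

theorem a_zero (α : ℝ) : a α 0 = 1 := by simp [a]

theorem a_succ (α : ℝ) (k : ℕ) : a α (k + 1) = a α k * (α - k) / (k + 1) := by
  have h : (k.factorial : ℝ) ≠ 0 := by positivity
  rw [a, a, Finset.prod_range_succ, Nat.factorial_succ]
  push_cast
  field_simp

theorem add_one_mul_a_succ (α : ℝ) (k : ℕ) : ((k : ℝ) + 1) * a α (k + 1) = α * a (α - 1) k := by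
  have h : (k.factorial : ℝ) ≠ 0 := by positivity
  have hprod : ∏ i ∈ Finset.range k, (α - ((i + 1 : ℕ) : ℝ)) =
      ∏ i ∈ Finset.range k, (α - 1 - i) :=
    Finset.prod_congr rfl fun i _ => by push_cast; ring
  rw [a, a, Finset.prod_range_succ', Nat.factorial_succ, hprod]
  push_cast
  field_simp
  ring

/-- The partial sum of the binomial series with `n` terms. -/
noncomputable def binomialPartialSum (α : ℝ) (n : ℕ) (x : ℝ) : ℝ :=
  ∑ k ∈ Finset.range n, a α k * x ^ k

theorem binomialPartialSum_succ (α : ℝ) (n : ℕ) (x : ℝ) :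
    binomialPartialSum α (n + 1) x = binomialPartialSum α n x + a α n * x ^ n :=
  Finset.sum_range_succ _ _

theorem binomialPartialSum_succ_zero (α : ℝ) (n : ℕ) : binomialPartialSum α (n + 1) 0 = 1 := by
  simp [binomialPartialSum, Finset.sum_range_succ', a_zero]

theorem hasDerivAt_binomialPartialSum_succ (α : ℝ) (n : ℕ) (x : ℝ) :
    HasDerivAt (binomialPartialSum α (n + 1)) (α * binomialPartialSum (α - 1) n x) x := by
  induction n with
  | zero =>
    have h : binomialPartialSum α (0 + 1) = fun _ => 1 := by
      ext y; simp [binomialPartialSum, a_zero]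
    rw [h]
    simpa [binomialPartialSum] using hasDerivAt_const x (1 : ℝ)
  | succ n ih =>
    have h : binomialPartialSum α (n + 1 + 1) =
        fun y => binomialPartialSum α (n + 1) y + a α (n + 1) * y ^ (n + 1) :=
      funext fun y => binomialPartialSum_succ α (n + 1) y
    rw [h]
    refine (ih.add ((hasDerivAt_pow (n + 1) x).const_mul (a α (n + 1)))).congr_deriv ?_
    rw [binomialPartialSum_succ, mul_add, ← mul_assoc α, ← add_one_mul_a_succ]
    push_cast
    ring

/-- The remainder of the binomial series has the sign of the first omitted term. -/
theorem a_mul_binomialPartialSum_sub_nonpos (n : ℕ) (α : ℝ) {x : ℝ} (hx : 0 ≤ x) :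
    a α n * (binomialPartialSum α n x - (1 + x) ^ α) ≤ 0 := by
  induction n generalizing α x with
  | zero =>
    have : 0 ≤ (1 + x) ^ α := by positivity
    simpa [a_zero, binomialPartialSum] using this
  | succ n ih =>
    set f : ℝ → ℝ := fun y => a α (n + 1) * (binomialPartialSum α (n + 1) y - (1 + y) ^ α) with hf
    have hderiv : ∀ y : ℝ, 0 ≤ y → HasDerivAt f
        (a α (n + 1) * (α * binomialPartialSum (α - 1) n y - α * (1 + y) ^ (α - 1))) y := by
      intro y hy
      have hpow : HasDerivAt (fun y : ℝ => (1 + y) ^ α) (α * (1 + y) ^ (α - 1)) y := by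
        have := ((hasDerivAt_id y).const_add 1).rpow_const (p := α)
          (Or.inl (by simp only [id]; positivity))
        simpa using this
      exact ((hasDerivAt_binomialPartialSum_succ α n y).sub hpow).const_mul _
    have hanti : AntitoneOn f (Set.Ici 0) := by
      refine antitoneOn_of_deriv_nonpos (convex_Ici 0)
        (fun y hy => (hderiv y hy).continuousAt.continuousWithinAt)
        (fun y hy => ?_) (fun y hy => ?_)
      · exact (hderiv y (interior_subset hy)).differentiableAt.differentiableWithinAt
      · have hy0 : 0 ≤ y := interior_subset hy
        rw [(hderiv y hy0).deriv]
        have hn : (0 : ℝ) < n + 1 := by positivity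
        have ha : a α (n + 1) = α * a (α - 1) n / (n + 1) := by
          rw [← add_one_mul_a_succ]; field_simp
        have heq : a α (n + 1) * (α * binomialPartialSum (α - 1) n y - α * (1 + y) ^ (α - 1)) =
            α ^ 2 / (n + 1) *
              (a (α - 1) n * (binomialPartialSum (α - 1) n y - (1 + y) ^ (α - 1))) := by
          rw [ha]; ring
        rw [heq]
        exact mul_nonpos_of_nonneg_of_nonpos (by positivity) (ih (α - 1) hy0)
    have h := hanti (Set.mem_Ici.2 le_rfl) (Set.mem_Ici.2 hx) hx
    simpa [hf, binomialPartialSum_succ_zero] using h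

/-- Beyond `x = 1` the terms of the binomial series eventually grow geometrically. -/
theorem exists_geometric_growth {x : ℝ} (hx : 1 < x) (α : ℝ) :
    ∃ c > 0, ∃ N : ℕ, ∀ k ≥ N, (1 + c) * |a α k * x ^ k| ≤ |a α (k + 1) * x ^ (k + 1)| := by
  refine ⟨(x - 1) / 2, by linarith, ?_⟩
  obtain ⟨N, hN⟩ := exists_nat_ge ((2 * x * |α| + x + 1) / (x - 1))
  refine ⟨N, fun k hk => ?_⟩
  have hkN : (2 * x * |α| + x + 1) / (x - 1) ≤ k := hN.trans (by exact_mod_cast hk)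
  rw [div_le_iff₀ (by linarith)] at hkN
  have hk1 : (0 : ℝ) < k + 1 := by positivity
  have hratio : 1 + (x - 1) / 2 ≤ x * |α - k| / (k + 1) := by
    rw [le_div_iff₀ hk1]
    have h1 : (k : ℝ) - |α| ≤ |α - k| := by
      have h2 := neg_abs_le (α - k)
      have h3 := le_abs_self α
      linarith
    nlinarith [mul_le_mul_of_nonneg_left h1 (by linarith : (0 : ℝ) ≤ x)]
  have heq : |a α (k + 1) * x ^ (k + 1)| = x * |α - k| / (k + 1) * |a α k * x ^ k| := by
    rw [a_succ, pow_succ, abs_mul, abs_div, abs_mul, abs_mul, abs_mul, abs_of_pos hk1,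
      abs_of_pos (by linarith : 0 < x)]
    ring
  rw [heq]
  exact mul_le_mul_of_nonneg_right hratio (abs_nonneg _)

section NonInteger

variable {α : ℝ}

theorem a_pos_of_le_floor_add_one (hα : 0 ≤ α) (hαni : ∀ n : ℤ, α ≠ n) {k : ℕ}
    (hk : k ≤ ⌊α⌋₊ + 1) : 0 < a α k := by
  refine div_pos (Finset.prod_pos fun i hi => ?_) (by positivity)
  have hi' : i ≤ ⌊α⌋₊ := by have := Finset.mem_range.1 hi; omega
  have hle : (i : ℝ) ≤ α := (Nat.le_floor_iff hα).1 hi'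
  have hne : α ≠ i := by exact_mod_cast hαni i
  exact sub_pos.2 (lt_of_le_of_ne hle hne.symm)

theorem a_alternating (hα : 0 ≤ α) (hαni : ∀ n : ℤ, α ≠ n) (j : ℕ) :
    0 < a α (⌊α⌋₊ + 2 * j + 1) ∧ a α (⌊α⌋₊ + 2 * j + 1 + 1) < 0 := by
  have hstep : ∀ k : ℕ, ⌊α⌋₊ + 1 ≤ k → (α - k) / (k + 1) < 0 := by
    intro k hk
    have h1 : α < k := (Nat.floor_lt hα).1 hk
    exact div_neg_of_neg_of_pos (by linarith) (by positivity)
  have hneg : ∀ k : ℕ, ⌊α⌋₊ + 1 ≤ k → 0 < a α k → a α (k + 1) < 0 := by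
    intro k hk h
    rw [a_succ, mul_div_assoc]
    exact mul_neg_of_pos_of_neg h (hstep k hk)
  induction j with
  | zero =>
    have h := a_pos_of_le_floor_add_one hα hαni (le_refl (⌊α⌋₊ + 1))
    exact ⟨h, hneg _ le_rfl h⟩
  | succ j ih =>
    have h : 0 < a α (⌊α⌋₊ + 2 * (j + 1) + 1) := by
      rw [show ⌊α⌋₊ + 2 * (j + 1) + 1 = ⌊α⌋₊ + 2 * j + 1 + 1 + 1 by ring, a_succ, mul_div_assoc]
      exact mul_pos_of_neg_of_neg ih.2 (hstep _ (by omega))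
    exact ⟨h, hneg _ (by omega) h⟩

theorem one_add_rpow_le_binomialPartialSum (hα : 0 ≤ α) (hαni : ∀ n : ℤ, α ≠ n) (j : ℕ) {x : ℝ}
    (hx : 0 ≤ x) : (1 + x) ^ α ≤ binomialPartialSum α (⌊α⌋₊ + 2 * j + 1 + 1) x := by
  have h := a_mul_binomialPartialSum_sub_nonpos (⌊α⌋₊ + 2 * j + 1 + 1) α hx
  have hneg := (a_alternating hα hαni j).2
  by_contra! hlt
  exact absurd h (not_le.2 (mul_pos_of_neg_of_neg hneg (sub_neg.2 hlt)))

theorem tendsto_binomialPartialSum_atTop (hα : 0 ≤ α) (hαni : ∀ n : ℤ, α ≠ n) {x : ℝ}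
    (hx : 1 < x) :
    Tendsto (fun j : ℕ => binomialPartialSum α (⌊α⌋₊ + 2 * j + 1 + 1) x) atTop atTop := by
  obtain ⟨c, hc, N, hN⟩ := exists_geometric_growth hx α
  set u : ℕ → ℝ := fun k => |a α k * x ^ k| with hu
  have hx0 : 0 < x := by linarith
  set M := ⌊α⌋₊ + 2 * N + 1 + 1 with hM
  have hpos : 0 < u M :=
    abs_pos.2 (mul_ne_zero (a_alternating hα hαni N).2.ne (by positivity))
  have hmono : ∀ k ≥ M, u M ≤ u k := by
    intro k hk
    induction k, hk using Nat.le_induction with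
    | base => exact le_rfl
    | succ k hk ih =>
      have h1 := hN k (by omega)
      have h2 : 0 ≤ c * u k := mul_nonneg hc.le (abs_nonneg _)
      simp only [hu] at *
      linarith
  have hincr : ∀ j ≥ N, binomialPartialSum α (⌊α⌋₊ + 2 * j + 1 + 1) x + c * u M ≤
      binomialPartialSum α (⌊α⌋₊ + 2 * (j + 1) + 1 + 1) x := by
    intro j hj
    set k := ⌊α⌋₊ + 2 * j + 1 + 1 with hk
    have hidx : ⌊α⌋₊ + 2 * (j + 1) + 1 + 1 = k + 1 + 1 := by omega
    have hneg : u k = -(a α k * x ^ k) :=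
      abs_of_neg (mul_neg_of_neg_of_pos (a_alternating hα hαni j).2 (by positivity))
    have hpos' : u (k + 1) = a α (k + 1) * x ^ (k + 1) :=
      abs_of_pos (mul_pos (by
        have := (a_alternating hα hαni (j + 1)).1
        rwa [show ⌊α⌋₊ + 2 * (j + 1) + 1 = k + 1 by omega] at this) (by positivity))
    have hgrow : (1 + c) * u k ≤ u (k + 1) := hN k (by omega)
    have hle : c * u M ≤ c * u k := mul_le_mul_of_nonneg_left (hmono k (by omega)) hc.le
    rw [hidx, binomialPartialSum_succ α (k + 1), binomialPartialSum_succ α k]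
    linarith
  have hlin : ∀ i : ℕ, binomialPartialSum α (⌊α⌋₊ + 2 * N + 1 + 1) x + i * (c * u M) ≤
      binomialPartialSum α (⌊α⌋₊ + 2 * (i + N) + 1 + 1) x := by
    intro i
    induction i with
    | zero => simp
    | succ i ih =>
      have h := hincr (i + N) (by omega)
      rw [show i + 1 + N = i + N + 1 by ring]
      push_cast
      linarith
  refine (tendsto_add_atTop_iff_nat N).1 (tendsto_atTop_mono hlin ?_)
  exact tendsto_atTop_add_const_left _ _
    (tendsto_natCast_atTop_atTop.atTop_mul_const (mul_pos hc hpos))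

end NonInteger

/-- For non-integer `α > d/2` and truncation levels `K_J = ⌊α⌋ + 2J + 1`, the
integral over `{|ξ| ≥ 1}` of the reciprocal of the truncated Taylor polynomial
tends to `0` as `J → ∞`. -/
theorem stmt_12 (d : ℕ) (hd : 1 ≤ d) (α : ℝ) (hα : (d : ℝ) / 2 < α)
    (hαni : ∀ n : ℤ, α ≠ (n : ℝ)) :
    Tendsto (fun J : ℕ =>
        ∫ ξ in {ξ : EuclideanSpace ℝ (Fin d) | 1 ≤ ‖ξ‖},
          (∑ k ∈ Finset.range (⌊α⌋₊ + 2 * J + 1 + 1), a α k * ‖ξ‖ ^ (2 * k))⁻¹)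
      atTop (nhds 0) := by
  have hα0 : 0 ≤ α := le_trans (by positivity) hα.le
  have hsum : ∀ (n : ℕ) (ξ : EuclideanSpace ℝ (Fin d)),
      ∑ k ∈ Finset.range n, a α k * ‖ξ‖ ^ (2 * k) = binomialPartialSum α n (‖ξ‖ ^ 2) :=
    fun n ξ => by simp only [binomialPartialSum, pow_mul]
  have hmeas : MeasurableSet {ξ : EuclideanSpace ℝ (Fin d) | 1 ≤ ‖ξ‖} :=
    measurableSet_le measurable_const measurable_norm
  have hint : Integrable (fun ξ : EuclideanSpace ℝ (Fin d) =>
      (1 + ‖ξ‖ ^ 2) ^ (-(2 * α) / 2)) volume :=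
    integrable_rpow_neg_one_add_norm_sq (by
      rw [finrank_euclideanSpace_fin]; linarith)
  have hsphere : ∀ᵐ ξ : EuclideanSpace ℝ (Fin d), ‖ξ‖ ≠ 1 := by
    have h := Measure.addHaar_sphere_of_ne_zero
      (volume : Measure (EuclideanSpace ℝ (Fin d))) 0 one_ne_zero
    filter_upwards [measure_eq_zero_iff_ae_notMem.1 h] with ξ hξ
    simpa using hξ
  simp only [hsum]
  rw [← integral_zero (EuclideanSpace ℝ (Fin d)) ℝ
    (μ := volume.restrict {ξ : EuclideanSpace ℝ (Fin d) | 1 ≤ ‖ξ‖})]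
  refine tendsto_integral_of_dominated_convergence _ (fun J => ?_) hint.restrict
    (fun J => ae_of_all _ fun ξ => ?_) ?_
  · refine Measurable.aestronglyMeasurable (Measurable.inv ?_)
    unfold binomialPartialSum
    fun_prop
  · have hx : 0 ≤ ‖ξ‖ ^ 2 := by positivity
    have hle := one_add_rpow_le_binomialPartialSum hα0 hαni J hx
    have hpos : 0 < (1 + ‖ξ‖ ^ 2) ^ α := by positivity
    rw [Real.norm_of_nonneg (inv_nonneg.2 (hpos.le.trans hle)),
      show -(2 * α) / 2 = -α by ring, Real.rpow_neg (by positivity)]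
    exact inv_anti₀ hpos hle
  · filter_upwards [ae_restrict_mem hmeas, ae_restrict_of_ae hsphere] with ξ hξ hne
    have h1 : 1 < ‖ξ‖ := lt_of_le_of_ne hξ hne.symm
    exact (tendsto_binomialPartialSum_atTop hα0 hαni
      (one_lt_pow₀ h1 two_ne_zero)).inv_tendsto_atTop
end

section
/- Let $d \ge 1$, let $\alpha > d/2$ be a non-integer real number, $\kappa > 0$, $a_0 = 1$, $a_k = \alpha(\alpha-1)\cdots(\alpha-k+1)/k!$ for $k \ge 1$, and $K = \lfloor\alpha\rfloor + 2J + 1$ for an integer $J \ge 1$. Then for every $h > 0$ and every $\xi \in (-\pi,\pi)^d$, the discrete spectral denominator is strictly positive: $\sum_{k=0}^{K} a_k\, \kappa^{2(\alpha-k)}\, h^{-2k} \left( \sum_{p=1}^{d} (2 - 2\cos\xi_p) \right)^{k} > 0$. -/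
open Filter MeasureTheory

theorem succ_mul_a_succ (α : ℝ) (n : ℕ) : ((n : ℝ) + 1) * a α (n + 1) = (α - n) * a α n := by
  have h1 : (Nat.factorial n : ℝ) ≠ 0 := by positivity
  have h2 : (n : ℝ) + 1 ≠ 0 := by positivity
  unfold a
  rw [Finset.prod_range_succ, Nat.factorial_succ]
  push_cast
  field_simp

/-- The generalized binomial coefficients are positive up to index `⌊α⌋ + 1`. -/
theorem a_pos_of_le_floor_succ {α : ℝ} (hα : 0 ≤ α) (hni : ∀ n : ℤ, α ≠ (n : ℝ)) {k : ℕ}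
    (hk : k ≤ ⌊α⌋₊ + 1) : 0 < a α k := by
  refine div_pos (Finset.prod_pos fun i hi => ?_) (by positivity)
  have hi' : i ≤ ⌊α⌋₊ := by
    have := Finset.mem_range.1 hi
    omega
  have hle : (i : ℝ) ≤ α := (Nat.le_floor_iff hα).1 hi'
  have hne : α ≠ (i : ℝ) := by exact_mod_cast hni i
  exact sub_pos.2 (lt_of_le_of_ne hle hne.symm)

/-- Beyond index `⌊α⌋ + 1` the signs alternate, so every second coefficient is positive. -/
theorem a_floor_add_two_mul_add_one_pos {α : ℝ} (hα : 0 ≤ α) (hni : ∀ n : ℤ, α ≠ (n : ℝ))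
    (J : ℕ) : 0 < a α (⌊α⌋₊ + 2 * J + 1) := by
  induction J with
  | zero => exact a_pos_of_le_floor_succ hα hni (by omega)
  | succ J ih =>
    set n := ⌊α⌋₊ + 2 * J + 1 with hn
    have hlt : α < n := (Nat.lt_floor_add_one α).trans_le (by rw [hn]; push_cast; linarith)
    have h1 := succ_mul_a_succ α n
    have h2 := succ_mul_a_succ α (n + 1)
    push_cast at h2
    have hneg : a α (n + 1) < 0 := by
      have : ((n : ℝ) + 1) * a α (n + 1) < 0 := h1 ▸ mul_neg_of_neg_of_pos (by linarith) ih
      exact neg_of_mul_neg_right this (by positivity)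
    have hpos : 0 < ((n : ℝ) + 1 + 1) * a α (n + 1 + 1) :=
      h2 ▸ mul_pos_of_neg_of_neg (by linarith) hneg
    have := pos_of_mul_pos_right hpos (by positivity)
    rwa [show ⌊α⌋₊ + 2 * (J + 1) + 1 = n + 1 + 1 by omega]

/-- The differential equation satisfied by the truncated binomial series. -/
theorem one_add_mul_deriv_truncated_binomial (α x : ℝ) (n : ℕ) :
    (1 + x) * ∑ k ∈ Finset.range (n + 1), a α k * (k * x ^ (k - 1)) =
      α * ∑ k ∈ Finset.range (n + 1), a α k * x ^ k + (n - α) * a α n * x ^ n := by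
  induction n with
  | zero => simp
  | succ n ih =>
    rw [Finset.sum_range_succ, mul_add, ih, Finset.sum_range_succ _ (n + 1)]
    push_cast
    linear_combination x ^ n * succ_mul_a_succ α n

/-- A truncated binomial series whose last coefficient is positive, with index at least `α`,
is positive on `[0, ∞)`. -/
theorem truncated_binomial_pos {α : ℝ} {n : ℕ} (hn : α ≤ n) (ha : 0 ≤ a α n)
    {x : ℝ} (hx : 0 ≤ x) : 0 < ∑ k ∈ Finset.range (n + 1), a α k * x ^ k := by
  set P : ℝ → ℝ := fun y => ∑ k ∈ Finset.range (n + 1), a α k * y ^ k with hP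
  have hderiv : ∀ y : ℝ, 0 ≤ y → HasDerivAt (fun y => P y * (1 + y) ^ (-α))
      ((n - α) * a α n * y ^ n * (1 + y) ^ (-α - 1)) y := by
    intro y hy
    have hy1 : 0 < 1 + y := by linarith
    have h1 : HasDerivAt P (∑ k ∈ Finset.range (n + 1), a α k * (k * y ^ (k - 1))) y :=
      HasDerivAt.fun_sum fun k _ => (hasDerivAt_pow k y).const_mul (a α k)
    have h2 : HasDerivAt (fun y : ℝ => (1 + y) ^ (-α)) (1 * (-α) * (1 + y) ^ (-α - 1)) y :=
      ((hasDerivAt_id y).const_add 1).rpow_const (Or.inl hy1.ne')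
    have hpow : (1 + y) ^ (-α) = (1 + y) * (1 + y) ^ (-α - 1) := by
      rw [Real.rpow_sub_one hy1.ne']
      field_simp
    refine (h1.mul h2).congr_deriv ?_
    rw [hpow]
    linear_combination (1 + y) ^ (-α - 1) * one_add_mul_deriv_truncated_binomial α y n
  have hmono : MonotoneOn (fun y => P y * (1 + y) ^ (-α)) (Set.Ici 0) := by
    refine monotoneOn_of_deriv_nonneg (convex_Ici 0)
      (fun y hy => (hderiv y hy).continuousAt.continuousWithinAt) ?_ ?_
    · intro y hy
      rw [interior_Ici] at hy
      exact (hderiv y (le_of_lt hy)).differentiableAt.differentiableWithinAt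
    · intro y hy
      rw [interior_Ici] at hy
      have hy0 : 0 < y := hy
      rw [(hderiv y hy0.le).deriv]
      have := sub_nonneg.2 hn
      positivity
  have hP0 : P 0 = 1 := by
    simp [hP, Finset.sum_range_succ', a]
  have hle := hmono (Set.mem_Ici.2 le_rfl) (Set.mem_Ici.2 hx) hx
  simp only [hP0, add_zero, Real.one_rpow, mul_one] at hle
  exact pos_of_mul_pos_left (one_pos.trans_le hle) (by positivity)

/-- Positivity of the discrete spectral denominator: for non-integer `α > d/2`,
`κ > 0`, `K = ⌊α⌋ + 2J + 1`, every `h > 0` and `ξ ∈ (-π,π)^d`,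
`∑_{k=0}^K a_k κ^{2(α-k)} h^{-2k} (∑_p (2 - 2cos ξ_p))^k > 0`. -/
theorem stmt_16 (d : ℕ) (hd : 1 ≤ d) (α : ℝ) (hα : (d : ℝ) / 2 < α)
    (hαni : ∀ n : ℤ, α ≠ (n : ℝ)) (κ : ℝ) (hκ : 0 < κ) (J : ℕ) (hJ : 1 ≤ J)
    (h : ℝ) (hh : 0 < h) (ξ : EuclideanSpace ℝ (Fin d))
    (hξ : ∀ p : Fin d, ξ p ∈ Set.Ioo (-Real.pi) Real.pi) :
    0 < ∑ k ∈ Finset.range (⌊α⌋₊ + 2 * J + 1 + 1),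
        a α k * κ ^ (2 * (α - (k : ℝ))) * h⁻¹ ^ (2 * k) *
          (∑ p : Fin d, (2 - 2 * Real.cos (ξ p))) ^ k := by
  have hα0 : 0 ≤ α := le_trans (by positivity) hα.le
  set S := ∑ p : Fin d, (2 - 2 * Real.cos (ξ p)) with hS
  have hS0 : 0 ≤ S := Finset.sum_nonneg fun p _ => by linarith [Real.cos_le_one (ξ p)]
  have hfloor : α ≤ ((⌊α⌋₊ + 2 * J + 1 : ℕ) : ℝ) :=
    (Nat.lt_floor_add_one α).le.trans (by push_cast; linarith)
  have hpos := truncated_binomial_pos hfloor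
    (a_floor_add_two_mul_add_one_pos hα0 hαni J).le
    (show 0 ≤ S / (κ ^ 2 * h ^ 2) by positivity)
  refine (mul_pos (Real.rpow_pos_of_pos hκ (2 * α)) hpos).trans_eq ?_
  rw [Finset.mul_sum]
  refine Finset.sum_congr rfl fun k _ => ?_
  have hk : κ ^ (2 * (α - (k : ℝ))) = κ ^ (2 * α) / κ ^ (2 * k) := by
    rw [mul_sub, Real.rpow_sub hκ, ← Real.rpow_natCast κ (2 * k)]
    push_cast
    rfl
  rw [hk, div_pow, mul_pow, ← pow_mul, ← pow_mul, inv_pow]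
  field_simp
end
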